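/- Fix x ∈ 𝒳 with P(X = x) > 0 and suppose: (Randomization) under P(·|S = e, X = x), D is independent of the pair (Y(0), Y(1)); (Positivity) P(S = e, X = x, D = d, Y = y) > 0 and P(S = o, X = x, Y = y) > 0 for all d, y ∈ {0, 1}; (Stability) R is conditionally independent of S given (X, D, Y); (No direct effect) R is conditionally independent of D given (X, Y). Then for each d ∈ {0, 1}, writing μ(d, x) := E[Y(d) | S = e, X = x], one has the equality of measures on ℛ: law(R | S = e, X = x, D = d) = μ(d, x)·law(R | S = o, X = x, Y = 1) + (1 − μ(d, x))·law(R | S = o, X = x, Y = 0). -/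

import Mathlib

open MeasureTheory ProbabilityTheory

noncomputable section

/-- Sample indicator values: experimental (`e`) or observational (`o`). -/
inductive Sample : Type
  | e
  | o
deriving DecidableEq

instance : MeasurableSpace Sample := ⊤

/-- Real-valued indicator of a boolean (`{0,1}`-valued variable). -/
def b2r (b : Bool) : ℝ := if b then 1 else 0

/-- `CondIndepOf P R V W` : the conditional law of `R` given `V = v, W = w` agrees with
the conditional law of `R` given `V = v`, for all values with positive probability;
this is the notion of "R is conditionally independent of W given V" for variables with
countable ranges. -/
def CondIndepOf {Ω 𝓡 V W : Type*} [MeasurableSpace Ω] [MeasurableSpace 𝓡]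
    (P : Measure Ω) (R : Ω → 𝓡) (Vf : Ω → V) (Wf : Ω → W) : Prop :=
  ∀ v w, 0 < P {ω | Vf ω = v ∧ Wf ω = w} →
    (P[|{ω | Vf ω = v ∧ Wf ω = w}]).map R = (P[|{ω | Vf ω = v}]).map R

/-- A conditional law is the mixture of the laws obtained by conditioning further on the values
of a variable with finite range. -/
lemma map_cond_eq_sum {Ω 𝓡 ι : Type*} [MeasurableSpace Ω] [MeasurableSpace 𝓡] [Fintype ι]
    [MeasurableSpace ι] [MeasurableSingletonClass ι] (P : Measure Ω) [IsFiniteMeasure P]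
    {R : Ω → 𝓡} (hR : Measurable R) {Z : Ω → ι} (hZ : Measurable Z) {A : Set Ω}
    (hA : MeasurableSet A) :
    (P[|A]).map R = ∑ z, P[|A] (Z ⁻¹' {z}) • (P[|A ∩ Z ⁻¹' {z}]).map R := by
  conv_lhs => rw [← sum_meas_smul_cond_fiber hZ (P[|A])]
  rw [Measure.map_finset_sum' hR.aemeasurable]
  refine Finset.sum_congr rfl fun z _ => ?_
  rw [Measure.map_smul, cond_cond_eq_cond_inter hA (hZ (.singleton z))]

/-- If the conditional law of `R` does not depend on the value of a variable with finite range,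
then it equals the law obtained without conditioning on that variable. -/
lemma map_cond_eq_of_forall {Ω 𝓡 ι : Type*} [MeasurableSpace Ω] [MeasurableSpace 𝓡] [Fintype ι]
    [MeasurableSpace ι] [MeasurableSingletonClass ι] (P : Measure Ω) [IsFiniteMeasure P]
    {R : Ω → 𝓡} (hR : Measurable R) {Z : Ω → ι} (hZ : Measurable Z) {A : Set Ω}
    (hA : MeasurableSet A) (hPA : P A ≠ 0) {ν : Measure 𝓡}
    (h : ∀ z, 0 < P (A ∩ Z ⁻¹' {z}) → (P[|A ∩ Z ⁻¹' {z}]).map R = ν) :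
    (P[|A]).map R = ν := by
  have := cond_isProbabilityMeasure hPA
  have hterm (z : ι) : P[|A] (Z ⁻¹' {z}) • (P[|A ∩ Z ⁻¹' {z}]).map R =
      P[|A] (Z ⁻¹' {z}) • ν := by
    rcases eq_zero_or_pos (P (A ∩ Z ⁻¹' {z})) with h0 | hpos
    · simp [cond_apply hA, h0]
    · rw [h z hpos]
  rw [map_cond_eq_sum P hR hZ hA, Finset.sum_congr rfl fun z _ => hterm z, ← Finset.sum_smul,
    sum_measure_preimage_singleton _ fun z _ => hZ (.singleton z)]
  simp

/-- Conditioning on an independent event of positive probability does not change probabilities. -/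
lemma ProbabilityTheory.IndepFun.cond_preimage_apply {Ω α β : Type*} [MeasurableSpace Ω]
    [MeasurableSpace α] [MeasurableSpace β] {Q : Measure Ω} [IsFiniteMeasure Q] {f : Ω → α}
    {g : Ω → β} (h : IndepFun f g Q) (hf : Measurable f) {s : Set α} {t : Set β}
    (hs : MeasurableSet s) (ht : MeasurableSet t) (h0 : Q (f ⁻¹' s) ≠ 0) :
    Q[|f ⁻¹' s] (g ⁻¹' t) = Q (g ⁻¹' t) := by
  rw [cond_apply (hf hs), h.measure_inter_preimage_eq_mul s t hs ht, ← mul_assoc,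
    ENNReal.inv_mul_cancel h0 (measure_ne_top _ _), one_mul]

/-- The mean of a binary variable is the probability that it equals one. -/
lemma integral_b2r {Ω : Type*} [MeasurableSpace Ω] (Q : Measure Ω) {Z : Ω → Bool}
    (hZ : Measurable Z) : ∫ ω, b2r (Z ω) ∂Q = Q.real (Z ⁻¹' {true}) := by
  rw [← integral_indicator_one (hZ (.singleton true))]
  refine integral_congr_ae (.of_forall fun ω => ?_)
  by_cases h : Z ω = true <;> simp [b2r, h]

/-- **Lemma 1 (Identification as generative model), binary outcome.**
Under experimental randomization, positivity, stability of the RSV across samples, and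
no direct effect of the treatment on the RSV, the conditional law of the RSV in the
experimental sample given treatment `d` is the `μ(d,x)`-mixture of the observational
conditional laws of the RSV given the outcome. -/
theorem statement0
    {Ω 𝓡 𝓧 : Type*} [MeasurableSpace Ω] [MeasurableSpace 𝓡] [StandardBorelSpace 𝓡]
    [MeasurableSpace 𝓧] [MeasurableSingletonClass 𝓧] [Countable 𝓧]
    (P : Measure Ω) [IsProbabilityMeasure P]
    (S : Ω → Sample) (D : Ω → Bool) (Y0 Y1 : Ω → Bool) (R : Ω → 𝓡) (X : Ω → 𝓧)
    (hS : Measurable S) (hD : Measurable D) (hY0 : Measurable Y0) (hY1 : Measurable Y1)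
    (hR : Measurable R) (hX : Measurable X)
    (Y : Ω → Bool) (hYdef : ∀ ω, Y ω = if D ω then Y1 ω else Y0 ω)
    (x : 𝓧) (hx : 0 < P {ω | X ω = x})
    -- Randomization: D ⫫ (Y(0), Y(1)) under P(·|S = e, X = x)
    (randomization :
      IndepFun D (fun ω => (Y0 ω, Y1 ω)) (P[|{ω | S ω = Sample.e ∧ X ω = x}]))
    -- Positivity
    (positivity_e : ∀ d y : Bool,
      0 < P {ω | S ω = Sample.e ∧ X ω = x ∧ D ω = d ∧ Y ω = y})
    (positivity_o : ∀ y : Bool,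
      0 < P {ω | S ω = Sample.o ∧ X ω = x ∧ Y ω = y})
    -- Stability: R ⫫ S | (X, D, Y)
    (stability : CondIndepOf P R (fun ω => (X ω, D ω, Y ω)) S)
    -- No direct effect: R ⫫ D | (X, Y)
    (noDirectEffect : CondIndepOf P R (fun ω => (X ω, Y ω)) D)
    (d : Bool)
    -- μ(d, x) := E[Y(d) | S = e, X = x]
    (μdx : ℝ)
    (hμdx : μdx = ∫ ω, b2r (if d then Y1 ω else Y0 ω)
        ∂(P[|{ω | S ω = Sample.e ∧ X ω = x}])) :
    (P[|{ω | S ω = Sample.e ∧ X ω = x ∧ D ω = d}]).map R =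
      ENNReal.ofReal μdx •
          (P[|{ω | S ω = Sample.o ∧ X ω = x ∧ Y ω = true}]).map R +
        ENNReal.ofReal (1 - μdx) •
          (P[|{ω | S ω = Sample.o ∧ X ω = x ∧ Y ω = false}]).map R := by
  set E : Set Ω := {ω | S ω = Sample.e ∧ X ω = x} with hE
  have hSm (s : Sample) : MeasurableSet {ω | S ω = s} := hS (t := {s}) trivial
  have hXm : MeasurableSet {ω | X ω = x} := hX (.singleton x)
  have hDm (a : Bool) : MeasurableSet {ω | D ω = a} := hD (.singleton a)
  have hEm : MeasurableSet E := (hSm _).inter hXm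
  have hYm : Measurable Y := by
    rw [funext hYdef]
    exact Measurable.ite (hDm true) hY1 hY0
  have hlaw (s : Sample) (a y : Bool) (h : 0 < P {ω | S ω = s ∧ X ω = x ∧ D ω = a ∧ Y ω = y}) :
      (P[|{ω | S ω = s ∧ X ω = x ∧ D ω = a ∧ Y ω = y}]).map R =
        (P[|{ω | (X ω, Y ω) = (x, y)}]).map R := by
    have h₁ : {ω | S ω = s ∧ X ω = x ∧ D ω = a ∧ Y ω = y} =
        {ω | (X ω, D ω, Y ω) = (x, a, y) ∧ S ω = s} := by
      ext ω; simp only [Set.mem_ofPred_eq, Prod.mk.injEq]; tauto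
    have h₂ : {ω | (X ω, D ω, Y ω) = (x, a, y)} = {ω | (X ω, Y ω) = (x, y) ∧ D ω = a} := by
      ext ω; simp only [Set.mem_ofPred_eq, Prod.mk.injEq]; tauto
    rw [h₁] at h ⊢
    rw [stability (x, a, y) s h, h₂]
    refine noDirectEffect (x, y) a ?_
    rw [← h₂]
    exact h.trans_le (measure_mono fun ω hω => hω.1)
  have hobs (y : Bool) : (P[|{ω | S ω = Sample.o ∧ X ω = x ∧ Y ω = y}]).map R =
      (P[|{ω | (X ω, Y ω) = (x, y)}]).map R := by
    have hm : MeasurableSet {ω | S ω = Sample.o ∧ X ω = x ∧ Y ω = y} :=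
      (hSm _).inter (hXm.inter (hYm (.singleton y)))
    refine map_cond_eq_of_forall P hR hD hm (positivity_o y).ne' fun a ha => ?_
    have hset : {ω | S ω = Sample.o ∧ X ω = x ∧ Y ω = y} ∩ D ⁻¹' {a} =
        {ω | S ω = Sample.o ∧ X ω = x ∧ D ω = a ∧ Y ω = y} := by
      ext ω
      simp only [Set.mem_inter_iff, Set.mem_ofPred_eq, Set.mem_preimage, Set.mem_singleton_iff]
      tauto
    rw [hset] at ha ⊢
    exact hlaw _ _ _ ha
  set Yd : Ω → Bool := fun ω => if d then Y1 ω else Y0 ω with hYd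
  have hYdm : Measurable Yd := by cases d <;> simpa [hYd]
  have hindep : IndepFun D Yd (P[|E]) :=
    randomization.comp (ψ := fun p : Bool × Bool => if d then p.2 else p.1) measurable_id
      (measurable_of_countable _)
  have hEd : {ω | S ω = Sample.e ∧ X ω = x ∧ D ω = d} = E ∩ D ⁻¹' {d} := by
    ext ω; simp [hE, and_assoc]
  have hEd0 : P (E ∩ D ⁻¹' {d}) ≠ 0 := by
    refine ((positivity_e d true).trans_le (measure_mono fun ω hω => ?_)).ne'
    exact ⟨⟨hω.1, hω.2.1⟩, hω.2.2.1⟩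
  have : IsProbabilityMeasure (P[|E]) :=
    cond_isProbabilityMeasure fun h => hEd0 (measure_mono_null Set.inter_subset_left h)
  have hEdm : MeasurableSet (E ∩ D ⁻¹' {d}) := hEm.inter (hDm d)
  have hweight (y : Bool) : P[|E ∩ D ⁻¹' {d}] (Y ⁻¹' {y}) = P[|E] (Yd ⁻¹' {y}) := by
    have hQ : P[|E] (D ⁻¹' {d}) ≠ 0 := (cond_pos_of_inter_ne_zero hEm hEd0).ne'
    rw [← hindep.cond_preimage_apply hD (.singleton d) (.singleton y) hQ,
      cond_cond_eq_cond_inter hEm (hD (.singleton d)), cond_apply hEdm, cond_apply hEdm]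
    congr 2
    ext ω
    simp only [Set.mem_inter_iff, Set.mem_preimage, Set.mem_singleton_iff, and_congr_right_iff]
    rintro ⟨-, rfl⟩
    simp [hYdef, hYd]
  have hmean : μdx = (P[|E]).real (Yd ⁻¹' {true}) := by rw [hμdx, integral_b2r _ hYdm]
  have hmean' : 1 - μdx = (P[|E]).real (Yd ⁻¹' {false}) := by
    rw [hmean, ← probReal_compl_eq_one_sub (hYdm (.singleton true))]
    congr 1
    ext ω; simp
  have hexp (y : Bool) : (P[|(E ∩ D ⁻¹' {d}) ∩ Y ⁻¹' {y}]).map R =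
      (P[|{ω | (X ω, Y ω) = (x, y)}]).map R := by
    rw [← hlaw Sample.e d y (positivity_e d y)]
    congr 2
    ext ω; simp [hE, and_assoc]
  rw [hEd, map_cond_eq_sum P hR hYm hEdm, Fintype.sum_bool, hobs, hobs, hmean', hmean,
    ofReal_measureReal, ofReal_measureReal, hweight, hweight, hexp, hexp]
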